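/- arXiv:math/0611166 — 6 statements merged into one kernel-verified Lean document; each statement's English description precedes it below -/
import Mathlib

section
/- Random variables X_1,…,X_n whose joint distribution possesses the canonical representation with kernels g satisfying A1–A3 are r-independent (2 ≤ r < n) if and only if g_{i_1,…,i_c}(ξ_{i_1},…,ξ_{i_c}) = 0 almost surely for all 1 ≤ i_1 < ⋯ < i_c ≤ n and c = 2,…,r. -/
open MeasureTheory Finset

/-- A function `g` on `ℝⁿ` depends only on the coordinates in `S`
(i.e., it is really a function of the variables `x_i`, `i ∈ S`). -/
def DependsOnlyOn {n : ℕ} (S : Finset (Fin n)) (g : (Fin n → ℝ) → ℝ) : Prop :=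
  ∀ x y : Fin n → ℝ, (∀ i ∈ S, x i = y i) → g x = g y

/-- The sum of U-statistics `U_n(x) = Σ_{c=2}^n Σ_{i_1<⋯<i_c} g_{i_1,…,i_c}(x_{i_1},…,x_{i_c})`,
where the kernel for the index set `S = {i_1,…,i_c}` is `g S`. -/
noncomputable def Usum {n : ℕ} (g : Finset (Fin n) → (Fin n → ℝ) → ℝ) (x : Fin n → ℝ) : ℝ :=
  ∑ S ∈ Finset.univ.filter (fun S : Finset (Fin n) => 2 ≤ S.card), g S x

/-- Conditions A1 (integrability), A2 (degeneracy: zero mean in each argument, a.s. in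
the remaining arguments) and A3 (positive definiteness: `U_n ≥ -1` a.s.) for a family of
Borel kernels `g_{i_1,…,i_c}`, with respect to independent random variables `ξ_1,…,ξ_n`
with distributions `μ_1,…,μ_n` (whose joint law is `Measure.pi μ`). -/
def IsKernelSystem {n : ℕ} (μ : Fin n → Measure ℝ) (g : Finset (Fin n) → (Fin n → ℝ) → ℝ) :
    Prop :=
  (∀ S : Finset (Fin n), 2 ≤ S.card →
      Measurable (g S) ∧ DependsOnlyOn S (g S) ∧
      Integrable (g S) (Measure.pi μ) ∧
      ∀ k ∈ S, ∀ᵐ x ∂Measure.pi μ, ∫ t, g S (Function.update x k t) ∂μ k = 0) ∧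
  (∀ᵐ x ∂Measure.pi μ, -1 ≤ Usum g x)

theorem measurePreserving_update {ι : Type*} [Fintype ι] [DecidableEq ι] {α : ι → Type*}
    [∀ i, MeasurableSpace (α i)] (μ : ∀ i, Measure (α i)) [∀ i, IsProbabilityMeasure (μ i)]
    (k : ι) :
    MeasurePreserving (fun p : (∀ i, α i) × α k => Function.update p.1 k p.2)
      ((Measure.pi μ).prod (μ k)) (Measure.pi μ) := by
  have hm : Measurable (fun p : (∀ i, α i) × α k => Function.update p.1 k p.2) := by
    refine measurable_pi_iff.2 fun i => ?_
    by_cases h : i = k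
    · subst h
      simpa using measurable_snd
    · simp only [Function.update_of_ne h]
      fun_prop
  refine ⟨hm, (Measure.pi_eq fun s hs => ?_).symm⟩
  rw [Measure.map_apply hm (MeasurableSet.univ_pi hs)]
  have hpre : (fun p : (∀ i, α i) × α k => Function.update p.1 k p.2) ⁻¹' Set.univ.pi s
      = Set.univ.pi (Function.update s k Set.univ) ×ˢ s k := by
    ext ⟨x, t⟩
    simp only [Set.mem_preimage, Set.mem_pi, Set.mem_univ, true_imp_iff, Set.mem_prod]
    constructor
    · intro h
      refine ⟨fun i => ?_, by simpa using h k⟩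
      by_cases hi : i = k
      · subst hi
        simp
      · simpa [hi] using h i
    · rintro ⟨h, ht⟩ i
      by_cases hi : i = k
      · subst hi
        simpa using ht
      · simpa [hi] using h i
  rw [hpre, Measure.prod_prod, Measure.pi_pi, ← Finset.mul_prod_erase _ _ (Finset.mem_univ k),
    ← Finset.mul_prod_erase _ (fun i => μ i (s i)) (Finset.mem_univ k)]
  simp only [Function.update_self, measure_univ, one_mul]
  rw [mul_comm]
  congr 1
  refine Finset.prod_congr rfl fun i hi => ?_
  rw [Function.update_of_ne (Finset.ne_of_mem_erase hi)]

theorem setIntegral_pi_eq_zero_of_degenerate {ι : Type*} [Fintype ι] [DecidableEq ι]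
    {α : ι → Type*} [∀ i, MeasurableSpace (α i)] (μ : ∀ i, Measure (α i))
    [∀ i, IsProbabilityMeasure (μ i)] {f : (∀ i, α i) → ℝ} (hf : Integrable f (Measure.pi μ))
    {k : ι} (hk : ∀ᵐ x ∂Measure.pi μ, ∫ t, f (Function.update x k t) ∂μ k = 0)
    {T : Finset ι} (hkT : k ∉ T) {A : ∀ i, Set (α i)} (hA : ∀ i, MeasurableSet (A i)) :
    ∫ x in (T : Set ι).pi A, f x ∂Measure.pi μ = 0 := by
  have hR : MeasurableSet ((T : Set ι).pi A) :=
    MeasurableSet.pi T.countable_toSet fun i _ => hA i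
  have hmp := measurePreserving_update μ k
  have hint : Integrable (((T : Set ι).pi A).indicator f) (Measure.pi μ) := hf.indicator hR
  have hint' := hmp.integrable_comp_of_integrable hint
  rw [← integral_indicator hR, ← hmp.map_eq,
    integral_map hmp.measurable.aemeasurable (by rw [hmp.map_eq]; exact hint.1),
    integral_prod (fun p => ((T : Set ι).pi A).indicator f (Function.update p.1 k p.2)) hint']
  refine integral_eq_zero_of_ae ?_
  filter_upwards [hk] with x hx
  have hmem (t : α k) : Function.update x k t ∈ (T : Set ι).pi A ↔ x ∈ (T : Set ι).pi A := by
    refine forall₂_congr fun i hi => ?_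
    rw [Function.update_of_ne (fun h => hkT (by simpa [h] using hi))]
  by_cases hxR : x ∈ (T : Set ι).pi A
  · simpa [Set.indicator, hmem, hxR] using hx
  · simp [Set.indicator, hmem, hxR]

theorem ae_eq_zero_of_forall_setIntegral_univ_pi_eq_zero {ι : Type*} [Fintype ι]
    {α : ι → Type*} [∀ i, MeasurableSpace (α i)] {ρ : Measure (∀ i, α i)} {f : (∀ i, α i) → ℝ}
    (hf : Integrable f ρ)
    (h : ∀ A : ∀ i, Set (α i), (∀ i, MeasurableSet (A i)) → ∫ x in Set.univ.pi A, f x ∂ρ = 0) :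
    f =ᵐ[ρ] 0 := by
  have huniv : ∫ x, f x ∂ρ = 0 := by
    simpa using h (fun _ => Set.univ) fun _ => MeasurableSet.univ
  suffices hs : ∀ s, MeasurableSet s → ∫ x in s, f x ∂ρ = 0 from
    hf.ae_eq_zero_of_forall_setIntegral_eq_zero fun s hs' _ => hs s hs'
  refine MeasurableSpace.induction_on_inter (C := fun s _ => ∫ x in s, f x ∂ρ = 0)
    generateFrom_pi.symm isPiSystem_pi (by simp) ?_ ?_ ?_
  · rintro _ ⟨A, hA, rfl⟩
    exact h A fun i => hA i (Set.mem_univ i)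
  · intro s hs ih
    have := integral_add_compl hs hf
    linarith
  · intro s hd hs ih
    rw [integral_iUnion hs hd hf.integrableOn]
    simp [ih]

theorem DependsOnlyOn.ae_eq_zero_of_forall_setIntegral_pi_eq_zero {n : ℕ} {T : Finset (Fin n)}
    {f : (Fin n → ℝ) → ℝ} (hT : DependsOnlyOn T f) (hm : Measurable f)
    {P : Measure (Fin n → ℝ)} (hf : Integrable f P)
    (h : ∀ A : Fin n → Set ℝ, (∀ i, MeasurableSet (A i)) →
      ∫ x in (T : Set (Fin n)).pi A, f x ∂P = 0) :
    f =ᵐ[P] 0 := by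
  let e : (T → ℝ) → Fin n → ℝ := fun y i => if hi : i ∈ T then y ⟨i, hi⟩ else 0
  have he : Measurable e := by
    refine measurable_pi_iff.2 fun i => ?_
    by_cases hi : i ∈ T
    · simp only [e, hi, dite_true]
      fun_prop
    · simp [e, hi]
  let p : (Fin n → ℝ) → T → ℝ := fun x i => x i
  have hp : Measurable p := by fun_prop
  have hfe : (fun x => f (e (p x))) = f := by
    funext x
    exact hT _ _ fun i hi => by simp [e, p, hi]
  have hint : Integrable (f ∘ e) (P.map p) := by
    rw [integrable_map_measure (hm.comp he).aestronglyMeasurable hp.aemeasurable]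
    simpa only [Function.comp_def, hfe] using hf
  have hzero : f ∘ e =ᵐ[P.map p] 0 := by
    refine ae_eq_zero_of_forall_setIntegral_univ_pi_eq_zero hint fun A hA => ?_
    rw [setIntegral_map (MeasurableSet.univ_pi hA) (hm.comp he).aestronglyMeasurable
      hp.aemeasurable]
    have hpre : p ⁻¹' Set.univ.pi A = (T : Set (Fin n)).pi
        (fun i => if hi : i ∈ T then A ⟨i, hi⟩ else Set.univ) := by
      ext x
      simp only [Set.mem_preimage, Set.mem_pi, Set.mem_univ, true_imp_iff, Finset.mem_coe, p]
      constructor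
      · intro hx i hi
        simpa [hi] using hx ⟨i, hi⟩
      · rintro hx ⟨i, hi⟩
        simpa [hi] using hx i hi
    simp only [Function.comp_def, hfe, hpre]
    refine h _ fun i => ?_
    split_ifs
    exacts [hA _, MeasurableSet.univ]
  have := ae_of_ae_map hp.aemeasurable hzero
  filter_upwards [this] with x hx
  rw [← congrFun hfe x]
  exact hx

namespace IsKernelSystem

variable {n : ℕ} {μ : Fin n → Measure ℝ} {g : Finset (Fin n) → (Fin n → ℝ) → ℝ}

theorem integrable_Usum (hg : IsKernelSystem μ g) : Integrable (Usum g) (Measure.pi μ) :=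
  integrable_finsetSum _ fun S hS => (hg.1 S (Finset.mem_filter.1 hS).2).2.2.1

variable [∀ i, IsProbabilityMeasure (μ i)]

theorem withDensity_pi (hg : IsKernelSystem μ g) (T : Finset (Fin n)) {A : Fin n → Set ℝ}
    (hA : ∀ i, MeasurableSet (A i)) :
    ((Measure.pi μ).withDensity fun x => ENNReal.ofReal (1 + Usum g x)) ((T : Set (Fin n)).pi A)
      = ENNReal.ofReal (∫ x in (T : Set (Fin n)).pi A, (1 + Usum g x) ∂Measure.pi μ) := by
  rw [withDensity_apply _ (MeasurableSet.pi T.countable_toSet fun i _ => hA i),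
    ofReal_integral_eq_lintegral_ofReal]
  · exact ((integrable_const 1).add hg.integrable_Usum).integrableOn
  · refine ae_restrict_of_ae ?_
    filter_upwards [hg.2] with x hx
    simp only [Pi.zero_apply]
    linarith

theorem setIntegral_pi (hg : IsKernelSystem μ g) (T : Finset (Fin n)) {A : Fin n → Set ℝ}
    (hA : ∀ i, MeasurableSet (A i)) :
    ∫ x in (T : Set (Fin n)).pi A, (1 + Usum g x) ∂Measure.pi μ
      = (∏ i ∈ T, μ i (A i)).toReal + ∑ S ∈ T.powerset with 2 ≤ S.card,
          ∫ x in (T : Set (Fin n)).pi A, g S x ∂Measure.pi μ := by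
  rw [integral_add (integrable_const 1) hg.integrable_Usum.integrableOn]
  congr 1
  · simp [Measure.real]
  · unfold Usum
    rw [integral_finsetSum _ fun S hS =>
      (hg.1 S (Finset.mem_filter.1 hS).2).2.2.1.integrableOn]
    symm
    refine Finset.sum_subset (Finset.filter_subset_filter _ (Finset.subset_univ _)) ?_
    intro S hS hST
    have hcard := (Finset.mem_filter.1 hS).2
    have hnot : ¬ S ⊆ T := fun h => hST (by simp [h, hcard])
    obtain ⟨k, hkS, hkT⟩ := Finset.not_subset.1 hnot
    exact setIntegral_pi_eq_zero_of_degenerate μ (hg.1 S hcard).2.2.1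
      ((hg.1 S hcard).2.2.2 k hkS) hkT hA

theorem withDensity_pi_of_ae_eq_zero (hg : IsKernelSystem μ g) (T : Finset (Fin n))
    (hT : ∀ S ⊆ T, 2 ≤ S.card → g S =ᵐ[Measure.pi μ] 0) {A : Fin n → Set ℝ}
    (hA : ∀ i, MeasurableSet (A i)) :
    ((Measure.pi μ).withDensity fun x => ENNReal.ofReal (1 + Usum g x)) ((T : Set (Fin n)).pi A)
      = ∏ i ∈ T, μ i (A i) := by
  rw [hg.withDensity_pi T hA, hg.setIntegral_pi T hA, Finset.sum_eq_zero, add_zero,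
    ENNReal.ofReal_toReal (ENNReal.prod_ne_top fun i _ => measure_ne_top _ _)]
  intro S hS
  rw [Finset.mem_filter, Finset.mem_powerset] at hS
  exact integral_eq_zero_of_ae (ae_restrict_of_ae (hT S hS.1 hS.2))

theorem withDensity_eval (hg : IsKernelSystem μ g) (i : Fin n) {B : Set ℝ}
    (hB : MeasurableSet B) :
    ((Measure.pi μ).withDensity fun x => ENNReal.ofReal (1 + Usum g x)) {x | x i ∈ B}
      = μ i B := by
  have h := hg.withDensity_pi_of_ae_eq_zero {i} (fun S hS hcard => by
    have := Finset.card_le_card hS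
    rw [Finset.card_singleton] at this
    omega) (A := fun _ => B) (fun _ => hB)
  simpa [Set.pi] using h

theorem ae_eq_zero_of_withDensity_pi (hg : IsKernelSystem μ g) (T : Finset (Fin n))
    (hcard : 2 ≤ T.card) (hlt : ∀ S ⊂ T, 2 ≤ S.card → g S =ᵐ[Measure.pi μ] 0)
    (h : ∀ A : Fin n → Set ℝ, (∀ i, MeasurableSet (A i)) →
      ((Measure.pi μ).withDensity fun x => ENNReal.ofReal (1 + Usum g x))
        ((T : Set (Fin n)).pi A) = ∏ i ∈ T, μ i (A i)) :
    g T =ᵐ[Measure.pi μ] 0 := by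
  obtain ⟨hm, hdep, hint, -⟩ := hg.1 T hcard
  refine hdep.ae_eq_zero_of_forall_setIntegral_pi_eq_zero hm hint fun A hA => ?_
  have hsum := hg.setIntegral_pi T hA
  rw [Finset.sum_eq_single_of_mem T (by simp [hcard])] at hsum
  · have hnonneg : 0 ≤ ∫ x in (T : Set (Fin n)).pi A, (1 + Usum g x) ∂Measure.pi μ := by
      refine integral_nonneg_of_ae (ae_restrict_of_ae ?_)
      filter_upwards [hg.2] with x hx
      simp only [Pi.zero_apply]
      linarith
    have hν := h A hA
    rw [hg.withDensity_pi T hA] at hν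
    rw [← hν, ENNReal.toReal_ofReal hnonneg] at hsum
    linarith
  · intro S hS hne
    rw [Finset.mem_filter, Finset.mem_powerset] at hS
    exact integral_eq_zero_of_ae
      (ae_restrict_of_ae (hlt S (hS.1.ssubset_of_ne hne) hS.2))

end IsKernelSystem

/-- Theorem 5.8: random variables `X₁,…,Xₙ` whose joint law `ν` has the canonical
representation with kernels `g` satisfying A1–A3 are `r`-independent (`2 ≤ r < n`, i.e. any
`r` of them are jointly independent, expressed via product formulas on measurable
rectangles) if and only if all kernels of order at most `r` vanish almost surely. -/
theorem statement11 (n r : ℕ) (hr : 2 ≤ r) (hrn : r < n)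
    (μ : Fin n → Measure ℝ) [∀ i, IsProbabilityMeasure (μ i)]
    (g : Finset (Fin n) → (Fin n → ℝ) → ℝ) (hg : IsKernelSystem μ g)
    (ν : Measure (Fin n → ℝ))
    (hrep : ν = (Measure.pi μ).withDensity fun x => ENNReal.ofReal (1 + Usum g x)) :
    (∀ S : Finset (Fin n), S.card = r →
        ∀ A : Fin n → Set ℝ, (∀ i, MeasurableSet (A i)) →
          ν {x | ∀ i ∈ S, x i ∈ A i} = ∏ i ∈ S, ν {x | x i ∈ A i}) ↔
      (∀ S : Finset (Fin n), 2 ≤ S.card → S.card ≤ r →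
        g S =ᵐ[Measure.pi μ] 0) := by
  subst hrep
  constructor
  · intro h
    have hprod (T : Finset (Fin n)) (hT : T.card ≤ r) (A : Fin n → Set ℝ)
        (hA : ∀ i, MeasurableSet (A i)) :
        ((Measure.pi μ).withDensity fun x => ENNReal.ofReal (1 + Usum g x))
          ((T : Set (Fin n)).pi A) = ∏ i ∈ T, μ i (A i) := by
      obtain ⟨T', hTT', hT'⟩ := Finset.exists_superset_card_eq hT (by simpa using hrn.le)
      have hB (i : Fin n) : MeasurableSet (if i ∈ T then A i else Set.univ) := by
        split_ifs
        exacts [hA i, MeasurableSet.univ]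
      have h' := h T' hT' _ hB
      simp only [hg.withDensity_eval _ (hB _)] at h'
      rw [← Finset.prod_subset hTT' fun i _ hi => by simp [hi]] at h'
      convert h' using 1
      · congr 1
        ext x
        simp only [Set.mem_pi, Finset.mem_coe, Set.mem_ofPred_eq]
        constructor
        · intro hx i _
          by_cases hi : i ∈ T
          · simpa [hi] using hx i hi
          · simp [hi]
        · intro hx i hi
          simpa [hi] using hx i (hTT' hi)
      · exact Finset.prod_congr rfl fun i hi => by simp [hi]
    intro S
    induction S using Finset.strongInduction with
    | H S ih =>
      intro hS hSr
      exact hg.ae_eq_zero_of_withDensity_pi S hS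
        (fun S' hS' hcard => ih S' hS' hcard ((Finset.card_le_card hS'.1).trans hSr))
        (hprod S hSr)
  · intro h S hS A hA
    simp only [hg.withDensity_eval _ (hA _)]
    exact hg.withDensity_pi_of_ae_eq_zero S
      (fun S' hS' hcard => h S' hcard ((Finset.card_le_card hS').trans hS.le)) hA
end

section
/- Let α ∈ ℕ and let A_1,…,A_n be finite sets of real numbers with card(A_i) ≤ α + 1 for each i. Random variables X_1,…,X_n taking values in A_1,…,A_n respectively (with joint distribution absolutely continuous with respect to the product of marginals) form a multiplicative system of order α if and only if they are jointly independent. -/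
open MeasureTheory Finset

/-- A continuous function is integrable for a finite measure carried by a compact set. -/
theorem Continuous.integrable_of_ae_mem_isCompact {E : Type*} [TopologicalSpace E] [T2Space E]
    [MeasurableSpace E] [OpensMeasurableSpace E] {μ : Measure E} [IsFiniteMeasure μ]
    {K : Set E} (hK : IsCompact K) (hμ : ∀ᵐ x ∂μ, x ∈ K) {f : E → ℝ} (hf : Continuous f) :
    Integrable f μ := by
  have h : IntegrableOn f K μ := hf.continuousOn.integrableOn_compact hK
  rwa [IntegrableOn, Measure.restrict_eq_self_of_ae_mem hμ] at h

/-- If mixed moments up to order `α` factor, so do mixed expectations of polynomials of degree at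
most `α` in each coordinate. -/
theorem integral_prod_polynomial_eval_of_moments {ι : Type*} [Fintype ι] {α : ℕ}
    {ν : Measure (ι → ℝ)} {μ : ι → Measure ℝ}
    (hν : ∀ f : (ι → ℝ) → ℝ, Continuous f → Integrable f ν)
    (hμ : ∀ i, ∀ f : ℝ → ℝ, Continuous f → Integrable f (μ i))
    (hmom : ∀ a : ι → ℕ, (∀ j, a j ≤ α) →
      ∫ x, ∏ j, x j ^ a j ∂ν = ∏ j, ∫ t, t ^ a j ∂(μ j))
    (p : ι → Polynomial ℝ) (hp : ∀ j, (p j).natDegree < α + 1) :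
    ∫ x, ∏ j, (p j).eval (x j) ∂ν = ∏ j, ∫ t, (p j).eval t ∂(μ j) := by
  classical
  simp_rw [fun j t => Polynomial.eval_eq_sum_range' (hp j) t, Finset.prod_univ_sum]
  rw [integral_finsetSum _ fun a _ => hν _ (by fun_prop)]
  simp_rw [fun j => integral_finsetSum (μ := μ j) (range (α + 1))
    (f := fun k t => (p j).coeff k * t ^ k) fun k _ => hμ j _ (by fun_prop)]
  rw [Finset.prod_univ_sum]
  refine Finset.sum_congr rfl fun a ha => ?_
  have ha' : ∀ j, a j ≤ α := fun j => by
    simpa [Nat.lt_succ_iff] using Fintype.mem_piFinset.1 ha j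
  simp_rw [Finset.prod_mul_distrib, integral_const_mul, Finset.prod_mul_distrib, hmom a ha']

/-- Theorem 6.1: let `α ∈ ℕ` and let `A₁,…,Aₙ` be finite sets of real numbers with
`card(A_i) ≤ α + 1`. Random variables `X₁,…,Xₙ` (with joint law `ν`) taking values in
`A₁,…,Aₙ` respectively, whose joint distribution is absolutely continuous with respect to
the product of the marginals, form a multiplicative system of order `α`
(`E ∏ X_j^{a_j} = ∏ E X_j^{a_j}` for all exponents `a_j ∈ {0,1,…,α}`) if and only if they
are jointly independent (the joint law is the product of the marginals). -/
theorem statement12 (n : ℕ) (α : ℕ) (A : Fin n → Finset ℝ)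
    (hA : ∀ i, (A i).card ≤ α + 1)
    (ν : Measure (Fin n → ℝ)) [IsProbabilityMeasure ν]
    (hsupp : ν {x | ∀ i, x i ∈ (A i : Set ℝ)} = 1)
    (hac : ν ≪ Measure.pi fun i => ν.map fun x => x i) :
    (∀ a : Fin n → ℕ, (∀ j, a j ≤ α) →
        ∫ x, ∏ j, x j ^ a j ∂ν = ∏ j, ∫ t, t ^ a j ∂(ν.map fun x => x j)) ↔
      ν = Measure.pi fun i => ν.map fun x => x i := by
  classical
  have hprob : ∀ i, IsProbabilityMeasure (ν.map fun x => x i) := fun i =>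
    Measure.isProbabilityMeasure_map (measurable_pi_apply i).aemeasurable
  constructor
  · intro hmom
    have hS : MeasurableSet {x : Fin n → ℝ | ∀ i, x i ∈ (A i : Set ℝ)} := by
      rw [Set.ofPred_forall]
      exact MeasurableSet.iInter fun i => measurable_pi_apply i (A i).measurableSet
    have hae : ∀ᵐ x ∂ν, ∀ i, x i ∈ (A i : Set ℝ) :=
      (mem_ae_iff_prob_eq_one hS).2 hsupp
    have haei : ∀ i, ∀ᵐ t ∂(ν.map fun x => x i), t ∈ (A i : Set ℝ) := fun i =>
      (ae_map_iff (measurable_pi_apply i).aemeasurable (A i).measurableSet).2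
        (hae.mono fun x hx => hx i)
    have hK : IsCompact (Set.univ.pi fun i => (A i : Set ℝ)) :=
      isCompact_univ_pi fun i => (A i).finite_toSet.isCompact
    refine (Measure.pi_eq fun s hs => ?_).symm
    let p : Fin n → Polynomial ℝ := fun i =>
      Lagrange.interpolate (A i) id ((s i).indicator 1)
    have hpe : ∀ i, ∀ t ∈ (A i : Set ℝ), (p i).eval t = (s i).indicator 1 t := fun i t ht =>
      Lagrange.eval_interpolate_at_node (v := id) _ Function.injective_id.injOn ht
    have hpd : ∀ i, (p i).natDegree < α + 1 := fun i => by
      by_cases h0 : p i = 0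
      · simp [h0]
      · rw [Polynomial.natDegree_lt_iff_degree_lt h0]
        exact (Lagrange.degree_interpolate_lt (v := id) _ Function.injective_id.injOn).trans_le
          (by exact_mod_cast hA i)
    have key := integral_prod_polynomial_eval_of_moments
      (fun f hf => hf.integrable_of_ae_mem_isCompact hK (hae.mono fun x hx i _ => hx i))
      (fun i f hf => hf.integrable_of_ae_mem_isCompact (A i).finite_toSet.isCompact (haei i))
      hmom p hpd
    have hl : ∫ x, ∏ j, (p j).eval (x j) ∂ν = ν.real (Set.univ.pi s) := by
      rw [← integral_indicator_one (MeasurableSet.univ_pi hs)]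
      refine integral_congr_ae (hae.mono fun x hx => ?_)
      simp only [fun j => hpe j _ (hx j), Set.indicator_apply, Pi.one_apply, Set.mem_univ_pi,
        Finset.prod_ite_zero, Finset.prod_const_one, Finset.mem_univ, forall_const]
    have hr : ∀ j, ∫ t, (p j).eval t ∂(ν.map fun x => x j)
        = (ν.map fun x => x j).real (s j) := fun j => by
      rw [← integral_indicator_one (hs j)]
      exact integral_congr_ae ((haei j).mono fun t ht => hpe j t ht)
    rw [hl] at key
    simp_rw [hr, Measure.real] at key
    rw [← ENNReal.toReal_prod] at key
    exact (ENNReal.toReal_eq_toReal_iff' (measure_ne_top _ _)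
      (ENNReal.prod_ne_top fun j _ => measure_ne_top _ _)).1 key
  · intro h a _
    have := integral_fintype_prod_eq_prod (μ := fun i => ν.map fun x : Fin n → ℝ => x i)
      (fun j (t : ℝ) => t ^ a j)
    rwa [← h] at this
end

section
/- For random variables X_1,…,X_n whose joint distribution is absolutely continuous with respect to the product of their one-dimensional marginal distributions, the relative entropy and the multivariate Pearson coefficient satisfy δ_{X_1,…,X_n} ≤ log(1 + φ²_{X_1,…,X_n}) ≤ φ²_{X_1,…,X_n}. -/
open MeasureTheory Finset

/-- The product of the one-dimensional marginal distributions of a joint law `ν` on `ℝⁿ`: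
the joint law of independent copies `ξ₁,…,ξₙ` of the coordinates. -/
noncomputable def prodMarginals {n : ℕ} (ν : Measure (Fin n → ℝ)) : Measure (Fin n → ℝ) :=
  Measure.pi fun i => ν.map fun y => y i

/-- The density `G = dF/(dF₁⋯dFₙ)` of the joint law `ν` with respect to the product of its
one-dimensional marginals. -/
noncomputable def jointDensity {n : ℕ} (ν : Measure (Fin n → ℝ)) : (Fin n → ℝ) → ℝ :=
  fun x => (ν.rnDeriv (prodMarginals ν) x).toReal

/-- The multivariate analog of Pearson's `φ²` coefficient:
`φ² = ∫ G² dF₁⋯dFₙ - 1 = ∫ G dF - 1`. -/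
noncomputable def pearsonPhiSq {n : ℕ} (ν : Measure (Fin n → ℝ)) : ℝ :=
  (∫ x, jointDensity ν x ^ 2 ∂prodMarginals ν) - 1

/-- The relative entropy (Kullback–Leibler/Shannon mutual information)
`δ = ∫ log G dF`. -/
noncomputable def relEntropy {n : ℕ} (ν : Measure (Fin n → ℝ)) : ℝ :=
  ∫ x, Real.log (jointDensity ν x) ∂ν

/-- The multivariate divergence measure `D^ψ = ∫ ψ(G) dF₁⋯dFₙ` associated with a convex
function `ψ` with `ψ(1) = 0`. -/
noncomputable def divergenceD {n : ℕ} (ψ : ℝ → ℝ) (ν : Measure (Fin n → ℝ)) : ℝ :=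
  ∫ x, ψ (jointDensity ν x) ∂prodMarginals ν

/-- The generalized Tsallis entropy `ρ^{(q)} = (1/(1-q)) (1 - ∫ G^{1-q} dF₁⋯dFₙ)`. -/
noncomputable def tsallisEntropy {n : ℕ} (q : ℝ) (ν : Measure (Fin n → ℝ)) : ℝ :=
  (1 - ∫ x, jointDensity ν x ^ (1 - q) ∂prodMarginals ν) / (1 - q)

/-- The Hellinger distance `H = (½ ρ^{(1/2)})^{1/2}`. -/
noncomputable def hellingerDist {n : ℕ} (ν : Measure (Fin n → ℝ)) : ℝ :=
  Real.sqrt (tsallisEntropy (1 / 2) ν / 2)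

section RnDeriv

variable {α : Type*} {mα : MeasurableSpace α} {μ ν : Measure α}

/-- The second moment of the density of a probability measure is at least one. -/
theorem one_le_integral_toReal_rnDeriv_sq [IsProbabilityMeasure μ] [IsProbabilityMeasure ν]
    (hac : ν ≪ μ) (hint : Integrable (fun x => (ν.rnDeriv μ x).toReal ^ 2) μ) :
    1 ≤ ∫ x, (ν.rnDeriv μ x).toReal ^ 2 ∂μ := by
  have hG : Integrable (fun x => (ν.rnDeriv μ x).toReal) μ := Measure.integrable_toReal_rnDeriv
  have hG1 : ∫ x, (ν.rnDeriv μ x).toReal ∂μ = 1 := by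
    simp [Measure.integral_toReal_rnDeriv hac]
  have hle : ∫ x, (2 * (ν.rnDeriv μ x).toReal - 1) ∂μ ≤ ∫ x, (ν.rnDeriv μ x).toReal ^ 2 ∂μ :=
    integral_mono ((hG.const_mul 2).sub (integrable_const 1)) hint fun x => by
      nlinarith [sq_nonneg ((ν.rnDeriv μ x).toReal - 1)]
  rw [integral_sub (hG.const_mul 2) (integrable_const 1), integral_const_mul, hG1] at hle
  norm_num at hle
  exact hle

/-- The relative entropy is at most the logarithm of the second moment of the density. -/
theorem integral_log_toReal_rnDeriv_le [IsProbabilityMeasure μ] [IsProbabilityMeasure ν]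
    (hac : ν ≪ μ) (hint : Integrable (fun x => (ν.rnDeriv μ x).toReal ^ 2) μ) :
    ∫ x, Real.log (ν.rnDeriv μ x).toReal ∂ν ≤
      Real.log (∫ x, (ν.rnDeriv μ x).toReal ^ 2 ∂μ) := by
  have hM := one_le_integral_toReal_rnDeriv_sq hac hint
  by_cases hlog : Integrable (fun x => Real.log (ν.rnDeriv μ x).toReal) ν
  swap
  · rw [integral_undef hlog]
    exact Real.log_nonneg hM
  have hGν : Integrable (fun x => (ν.rnDeriv μ x).toReal) ν := by
    rw [← integrable_rnDeriv_smul_iff hac]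
    simpa only [smul_eq_mul, ← sq] using hint
  have hGM : ∫ x, (ν.rnDeriv μ x).toReal ∂ν = ∫ x, (ν.rnDeriv μ x).toReal ^ 2 ∂μ := by
    rw [← integral_rnDeriv_smul hac]
    simp only [smul_eq_mul, ← sq]
  set M := ∫ x, (ν.rnDeriv μ x).toReal ^ 2 ∂μ
  have hM0 : 0 < M := by linarith
  have hle : ∫ x, Real.log (ν.rnDeriv μ x).toReal ∂ν ≤
      ∫ x, ((ν.rnDeriv μ x).toReal / M + (Real.log M - 1)) ∂ν := by
    refine integral_mono_ae hlog ((hGν.div_const M).add (integrable_const _)) ?_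
    filter_upwards [Measure.rnDeriv_pos hac, hac.ae_le (ν.rnDeriv_lt_top μ)] with x hx0 hxt
    have hx := ENNReal.toReal_pos hx0.ne' hxt.ne
    have h := Real.log_le_sub_one_of_pos (div_pos hx hM0)
    rw [Real.log_div hx.ne' hM0.ne'] at h
    linarith
  rw [integral_add (hGν.div_const M) (integrable_const _), integral_div, hGM,
    div_self hM0.ne'] at hle
  simpa using hle

end RnDeriv

instance prodMarginals.instIsProbabilityMeasure {n : ℕ} (ν : Measure (Fin n → ℝ))
    [IsProbabilityMeasure ν] : IsProbabilityMeasure (prodMarginals ν) := by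
  have (i : Fin n) : IsProbabilityMeasure (ν.map fun y => y i) :=
    Measure.isProbabilityMeasure_map (measurable_pi_apply i).aemeasurable
  unfold prodMarginals
  infer_instance

/-- Theorem 7.1: for random variables `X₁,…,Xₙ` with joint law `ν` absolutely continuous
with respect to the product of their one-dimensional marginal distributions (and with
square-integrable density, so that the Pearson coefficient is defined), the relative entropy
and the multivariate Pearson coefficient satisfy
`δ ≤ log(1 + φ²) ≤ φ²`. -/
theorem statement13 (n : ℕ) (ν : Measure (Fin n → ℝ)) [IsProbabilityMeasure ν]
    (hac : ν ≪ prodMarginals ν)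
    (hG2 : Integrable (fun x => jointDensity ν x ^ 2) (prodMarginals ν)) :
    relEntropy ν ≤ Real.log (1 + pearsonPhiSq ν) ∧
      Real.log (1 + pearsonPhiSq ν) ≤ pearsonPhiSq ν := by
  have hM := one_le_integral_toReal_rnDeriv_sq hac hG2
  have hφ : 1 + pearsonPhiSq ν =
      ∫ x, (ν.rnDeriv (prodMarginals ν) x).toReal ^ 2 ∂prodMarginals ν :=
    add_sub_cancel _ _
  refine ⟨?_, ?_⟩
  · rw [hφ]
    exact integral_log_toReal_rnDeriv_le hac hG2
  · have := Real.log_le_sub_one_of_pos (x := 1 + pearsonPhiSq ν) (by linarith)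
    linarith
end

section
/- For an arbitrary Borel statistic h : ℝ^n → ℝ and random variables X_1,…,X_n whose joint distribution is absolutely continuous with respect to the product of their marginals, with ξ_1,…,ξ_n independent copies, the following holds for every x ∈ ℝ: |P(h(X_1,…,X_n) ≤ x) − P(h(ξ_1,…,ξ_n) ≤ x)| ≤ φ_{X_1,…,X_n} · max{ (P(h(ξ_1,…,ξ_n) ≤ x))^{1/2}, (P(h(ξ_1,…,ξ_n) > x))^{1/2} }. -/
open MeasureTheory Finset

/-- Cauchy–Schwarz for the difference of two probability measures on a measurable set, in terms
of the chi-square divergence. -/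
theorem abs_measure_sub_measure_le_sqrt_chiSq {α : Type*} [MeasurableSpace α] {μ ν : Measure α}
    [IsProbabilityMeasure μ] [IsProbabilityMeasure ν] (hac : ν ≪ μ)
    (hG2 : Integrable (fun a => (ν.rnDeriv μ a).toReal ^ 2) μ) {A : Set α}
    (hA : MeasurableSet A) :
    |ν.real A - μ.real A| ≤
      Real.sqrt ((∫ a, (ν.rnDeriv μ a).toReal ^ 2 ∂μ) - 1) * Real.sqrt (μ.real A) := by
  set G : α → ℝ := fun a => (ν.rnDeriv μ a).toReal with hG
  have hGi : Integrable G μ := Measure.integrable_toReal_rnDeriv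
  have hGint : ∫ a, G a ∂μ = 1 := by
    rw [Measure.integral_toReal_rnDeriv hac, probReal_univ]
  have hGA : ∫ a in A, G a ∂μ = ν.real A := Measure.setIntegral_toReal_rnDeriv hac A
  have hind : Integrable (A.indicator (1 : α → ℝ)) μ := (integrable_const 1).indicator hA
  have hindint : ∫ a, A.indicator (1 : α → ℝ) a ∂μ = μ.real A := integral_indicator_one hA
  have hGind : ∫ a, A.indicator G a ∂μ = ν.real A := by rw [integral_indicator hA, hGA]
  have key : ∀ t : ℝ, 0 ≤ μ.real A * (t * t) + -2 * (ν.real A - μ.real A) * t +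
      ((∫ a, G a ^ 2 ∂μ) - 1) := by
    intro t
    have hexp : ∀ a, (G a - 1 - t * A.indicator (1 : α → ℝ) a) ^ 2 =
        G a ^ 2 - 2 * G a + 1 - 2 * t * A.indicator G a +
          (2 * t + t ^ 2) * A.indicator (1 : α → ℝ) a := by
      intro a
      by_cases ha : a ∈ A <;> simp [ha] <;> ring
    have h0 : 0 ≤ ∫ a, (G a - 1 - t * A.indicator (1 : α → ℝ) a) ^ 2 ∂μ :=
      integral_nonneg fun a => sq_nonneg _
    have h1 : Integrable (fun a => G a ^ 2 - 2 * G a) μ := hG2.sub (hGi.const_mul 2)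
    have h2 : Integrable (fun a => G a ^ 2 - 2 * G a + 1) μ := h1.add (integrable_const 1)
    have h3 : Integrable (fun a => 2 * t * A.indicator G a) μ :=
      (hGi.indicator hA).const_mul (2 * t)
    have h4 : Integrable (fun a => G a ^ 2 - 2 * G a + 1 - 2 * t * A.indicator G a) μ :=
      h2.sub h3
    simp_rw [hexp] at h0
    rw [integral_add h4 (hind.const_mul _), integral_sub h2 h3,
      integral_add h1 (integrable_const 1), integral_sub hG2 (hGi.const_mul 2),
      integral_const_mul, integral_const_mul, integral_const_mul, hGint, hGind, hindint,
      integral_const, probReal_univ] at h0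
    simp only [smul_eq_mul] at h0
    linarith
  have hφ : 0 ≤ (∫ a, G a ^ 2 ∂μ) - 1 := by simpa using key 0
  have hdisc := discrim_le_zero key
  rw [discrim] at hdisc
  rw [← Real.sqrt_mul hφ]
  exact Real.abs_le_sqrt (by linarith)

/-- Theorem 7.3: for an arbitrary Borel statistic `h : ℝⁿ → ℝ` and random variables
`X₁,…,Xₙ` with joint law `ν` absolutely continuous w.r.t. the product of their marginals
(with square-integrable density, so that `φ` is defined), and independent copies `ξ₁,…,ξₙ`
(joint law `prodMarginals ν`),
`|P(h(X₁,…,Xₙ) ≤ x) - P(h(ξ₁,…,ξₙ) ≤ x)|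
  ≤ φ · max{ P(h(ξ) ≤ x)^{1/2}, P(h(ξ) > x)^{1/2} }` for every `x ∈ ℝ`. -/
theorem statement16 (n : ℕ) (ν : Measure (Fin n → ℝ)) [IsProbabilityMeasure ν]
    (hac : ν ≪ prodMarginals ν)
    (hG2 : Integrable (fun x => jointDensity ν x ^ 2) (prodMarginals ν))
    (h : (Fin n → ℝ) → ℝ) (hh : Measurable h) (x : ℝ) :
    |(ν {y | h y ≤ x}).toReal - (prodMarginals ν {y | h y ≤ x}).toReal| ≤
      Real.sqrt (pearsonPhiSq ν) *
        max (Real.sqrt ((prodMarginals ν {y | h y ≤ x}).toReal))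
          (Real.sqrt ((prodMarginals ν {y | x < h y}).toReal)) := by
  have hproj : ∀ i, IsProbabilityMeasure (ν.map fun y => y i) := fun i =>
    Measure.isProbabilityMeasure_map (measurable_pi_apply i).aemeasurable
  have hμ : IsProbabilityMeasure (prodMarginals ν) := by
    unfold prodMarginals
    infer_instance
  exact (abs_measure_sub_measure_le_sqrt_chiSq hac hG2
    (measurableSet_le hh measurable_const)).trans
    (mul_le_mul_of_nonneg_left (le_max_left _ _) (Real.sqrt_nonneg _))
end

section
/- Let X_1,…,X_n be random variables whose joint distribution is absolutely continuous with respect to the product of their marginals, and ξ_1,…,ξ_n independent copies. For every nonnegative Borel function f : ℝ^n → ℝ the following sharp inequalities hold: (i) E f(X_1,…,X_n) ≤ E exp(f(ξ_1,…,ξ_n)) − 1 + δ_{X_1,…,X_n}; (ii) for every q > 1, E f(X_1,…,X_n) ≤ (1 + D^ψ_{X_1,…,X_n})^{1−1/q} (E f^q(ξ_1,…,ξ_n))^{1/q}, where ψ(x) = |x|^{q/(q−1)} − 1. -/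
open MeasureTheory Finset

/-- Young's inequality for the conjugate pair `exp` and `b ↦ b log b - b`. -/
theorem mul_le_exp_sub_add_mul_log (a : ℝ) {b : ℝ} (hb : 0 ≤ b) :
    b * a ≤ Real.exp a - b + b * Real.log b := by
  rcases hb.eq_or_lt with rfl | hb
  · simpa using (Real.exp_pos a).le
  · have h := Real.add_one_le_exp (a - Real.log b)
    rw [Real.exp_sub, Real.exp_log hb, le_div_iff₀ hb] at h
    linarith

instance isProbabilityMeasure_prodMarginals {n : ℕ} (ν : Measure (Fin n → ℝ))
    [IsProbabilityMeasure ν] : IsProbabilityMeasure (prodMarginals ν) := by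
  have (i : Fin n) : IsProbabilityMeasure (ν.map fun y => y i) :=
    Measure.isProbabilityMeasure_map (measurable_pi_apply i).aemeasurable
  unfold prodMarginals
  infer_instance

instance haveLebesgueDecomposition_prodMarginals {n : ℕ} (ν : Measure (Fin n → ℝ))
    [IsProbabilityMeasure ν] : ν.HaveLebesgueDecomposition (prodMarginals ν) :=
  have : SigmaFinite ν := IsFiniteMeasure.toSigmaFinite ν
  have : SFinite ν := instSFiniteOfSigmaFinite
  have : SigmaFinite (prodMarginals ν) := IsFiniteMeasure.toSigmaFinite _
  Measure.haveLebesgueDecomposition_of_sigmaFinite ν (prodMarginals ν)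

theorem measurable_jointDensity {n : ℕ} (ν : Measure (Fin n → ℝ)) :
    Measurable (jointDensity ν) :=
  (Measure.measurable_rnDeriv _ _).ennreal_toReal

theorem jointDensity_nonneg {n : ℕ} (ν : Measure (Fin n → ℝ)) (x : Fin n → ℝ) :
    0 ≤ jointDensity ν x :=
  ENNReal.toReal_nonneg

theorem integral_jointDensity_mul {n : ℕ} {ν : Measure (Fin n → ℝ)} [IsProbabilityMeasure ν]
    (hac : ν ≪ prodMarginals ν) (f : (Fin n → ℝ) → ℝ) :
    ∫ x, jointDensity ν x * f x ∂prodMarginals ν = ∫ x, f x ∂ν :=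
  integral_rnDeriv_smul hac

theorem integrable_jointDensity_mul {n : ℕ} {ν : Measure (Fin n → ℝ)} [IsProbabilityMeasure ν]
    (hac : ν ≪ prodMarginals ν) {f : (Fin n → ℝ) → ℝ} (hf : Integrable f ν) :
    Integrable (fun x => jointDensity ν x * f x) (prodMarginals ν) :=
  (integrable_rnDeriv_smul_iff hac).2 hf

theorem integral_le_integral_exp_add_relEntropy {n : ℕ} {ν : Measure (Fin n → ℝ)}
    [IsProbabilityMeasure ν] (hac : ν ≪ prodMarginals ν)
    (hlog : Integrable (fun x => Real.log (jointDensity ν x)) ν) {f : (Fin n → ℝ) → ℝ}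
    (hf : Integrable f ν) (hexp : Integrable (fun x => Real.exp (f x)) (prodMarginals ν)) :
    ∫ x, f x ∂ν ≤ (∫ x, Real.exp (f x) ∂prodMarginals ν) - 1 + relEntropy ν := by
  have hG : Integrable (jointDensity ν) (prodMarginals ν) := by
    simpa using integrable_jointDensity_mul hac (integrable_const (1 : ℝ))
  have hG_one : ∫ x, jointDensity ν x ∂prodMarginals ν = 1 := by
    simpa using integral_jointDensity_mul hac fun _ => 1
  have hGlog := integrable_jointDensity_mul hac hlog
  calc ∫ x, f x ∂ν = ∫ x, jointDensity ν x * f x ∂prodMarginals ν :=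
        (integral_jointDensity_mul hac f).symm
    _ ≤ ∫ x, (Real.exp (f x) - jointDensity ν x
          + jointDensity ν x * Real.log (jointDensity ν x)) ∂prodMarginals ν :=
        integral_mono (integrable_jointDensity_mul hac hf) ((hexp.sub hG).add hGlog) fun x =>
          mul_le_exp_sub_add_mul_log (f x) (jointDensity_nonneg ν x)
    _ = (∫ x, Real.exp (f x) ∂prodMarginals ν) - 1 + relEntropy ν := by
        rw [integral_add (by exact hexp.sub hG) hGlog, integral_sub hexp hG, hG_one,
          integral_jointDensity_mul hac, relEntropy]

theorem one_add_divergenceD_rpow {n : ℕ} {ν : Measure (Fin n → ℝ)} [IsProbabilityMeasure ν]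
    {p : ℝ} (hG : Integrable (fun x => |jointDensity ν x| ^ p) (prodMarginals ν)) :
    1 + divergenceD (fun y => |y| ^ p - 1) ν
      = ∫ x, jointDensity ν x ^ p ∂prodMarginals ν := by
  rw [divergenceD, integral_sub hG (integrable_const 1)]
  simp [abs_of_nonneg (jointDensity_nonneg ν _)]

theorem memLp_of_integrable_rpow {α : Type*} [MeasurableSpace α] {μ : Measure α} {f : α → ℝ}
    (hf : AEStronglyMeasurable f μ) (h0 : ∀ x, 0 ≤ f x) {p : ℝ} (hp : 0 < p)
    (hfp : Integrable (fun x => f x ^ p) μ) : MemLp f (ENNReal.ofReal p) μ := by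
  refine (integrable_norm_rpow_iff hf (by simpa using hp) ENNReal.ofReal_ne_top).1 ?_
  simpa [ENNReal.toReal_ofReal hp.le, abs_of_nonneg (h0 _)] using hfp

theorem integral_le_one_add_divergenceD_rpow_mul {n : ℕ} {ν : Measure (Fin n → ℝ)}
    [IsProbabilityMeasure ν] (hac : ν ≪ prodMarginals ν) {q : ℝ} (hq : 1 < q)
    (hG : Integrable (fun x => |jointDensity ν x| ^ (q / (q - 1))) (prodMarginals ν))
    {f : (Fin n → ℝ) → ℝ} (hf : Measurable f) (h0 : ∀ x, 0 ≤ f x)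
    (hfq : Integrable (fun x => f x ^ q) (prodMarginals ν)) :
    ∫ x, f x ∂ν ≤
      (1 + divergenceD (fun y => |y| ^ (q / (q - 1)) - 1) ν) ^ (1 - 1 / q) *
        (∫ x, f x ^ q ∂prodMarginals ν) ^ (1 / q) := by
  have hpq : (q / (q - 1)).HolderConjugate q := (Real.HolderConjugate.conjExponent hq).symm
  have hexponent : 1 - 1 / q = 1 / (q / (q - 1)) := by
    have : q ≠ 0 := by positivity
    field_simp
  rw [one_add_divergenceD_rpow hG, ← integral_jointDensity_mul hac f, hexponent]
  have hG' : Integrable (fun x => jointDensity ν x ^ (q / (q - 1))) (prodMarginals ν) := by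
    simpa only [abs_of_nonneg (jointDensity_nonneg ν _)] using hG
  exact integral_mul_le_Lp_mul_Lq_of_nonneg hpq
    (ae_of_all _ (jointDensity_nonneg ν)) (ae_of_all _ h0)
    (memLp_of_integrable_rpow (measurable_jointDensity ν).aestronglyMeasurable
      (jointDensity_nonneg ν) hpq.pos hG')
    (memLp_of_integrable_rpow hf.aestronglyMeasurable h0 hpq.symm.pos hfq)

theorem prodMarginals_pi {n : ℕ} (μ : Fin n → Measure ℝ) [∀ i, IsProbabilityMeasure (μ i)] :
    prodMarginals (Measure.pi μ) = Measure.pi μ :=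
  congrArg Measure.pi <| funext fun i => (measurePreserving_eval μ i).map_eq

theorem jointDensity_pi {n : ℕ} (μ : Fin n → Measure ℝ) [∀ i, IsProbabilityMeasure (μ i)] :
    jointDensity (Measure.pi μ) =ᵐ[Measure.pi μ] fun _ => 1 := by
  unfold jointDensity
  rw [prodMarginals_pi]
  filter_upwards [Measure.rnDeriv_self (Measure.pi μ)] with x hx
  simp [hx]

theorem integrable_comp_jointDensity_pi {n : ℕ} (μ : Fin n → Measure ℝ)
    [∀ i, IsProbabilityMeasure (μ i)] (ψ : ℝ → ℝ) :
    Integrable (fun x => ψ (jointDensity (Measure.pi μ) x)) (Measure.pi μ) :=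
  (integrable_const (ψ 1)).congr ((jointDensity_pi μ).fun_comp ψ).symm

theorem integral_comp_jointDensity_pi {n : ℕ} (μ : Fin n → Measure ℝ)
    [∀ i, IsProbabilityMeasure (μ i)] (ψ : ℝ → ℝ) :
    ∫ x, ψ (jointDensity (Measure.pi μ) x) ∂Measure.pi μ = ψ 1 := by
  exact (integral_congr_ae ((jointDensity_pi μ).fun_comp ψ)).trans (by simp)

theorem relEntropy_pi {n : ℕ} (μ : Fin n → Measure ℝ) [∀ i, IsProbabilityMeasure (μ i)] :
    relEntropy (Measure.pi μ) = 0 :=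
  (integral_comp_jointDensity_pi μ Real.log).trans Real.log_one

theorem divergenceD_pi {n : ℕ} (μ : Fin n → Measure ℝ) [∀ i, IsProbabilityMeasure (μ i)]
    (ψ : ℝ → ℝ) : divergenceD ψ (Measure.pi μ) = ψ 1 := by
  rw [divergenceD, prodMarginals_pi, integral_comp_jointDensity_pi]

/-- Theorem 7.4, inequalities (7.9) and (7.10): for random variables `X₁,…,Xₙ` with joint law
`ν` absolutely continuous w.r.t. the product of their marginals, independent copies
`ξ₁,…,ξₙ` (joint law `prodMarginals ν`), and every nonnegative Borel `f`:
(i) `E f(X) ≤ E exp(f(ξ)) - 1 + δ` (when the relative entropy `δ` is defined);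
(ii) for every `q > 1`, `E f(X) ≤ (1 + D^ψ)^{1-1/q} (E f^q(ξ))^{1/q}`, where
`ψ(x) = |x|^{q/(q-1)} - 1`.
Both inequalities are sharp: equality is attained for some choice of the joint law and of
`f`. -/
theorem statement18 (n : ℕ) (ν : Measure (Fin n → ℝ)) [IsProbabilityMeasure ν]
    (hac : ν ≪ prodMarginals ν) :
    (Integrable (fun x => Real.log (jointDensity ν x)) ν →
      ∀ f : (Fin n → ℝ) → ℝ, Measurable f → (∀ x, 0 ≤ f x) →
        Integrable f ν → Integrable (fun x => Real.exp (f x)) (prodMarginals ν) →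
        ∫ x, f x ∂ν ≤
          (∫ x, Real.exp (f x) ∂prodMarginals ν) - 1 + relEntropy ν) ∧
    (∀ q : ℝ, 1 < q →
      Integrable (fun x => |jointDensity ν x| ^ (q / (q - 1))) (prodMarginals ν) →
      ∀ f : (Fin n → ℝ) → ℝ, Measurable f → (∀ x, 0 ≤ f x) →
        Integrable f ν → Integrable (fun x => f x ^ q) (prodMarginals ν) →
        ∫ x, f x ∂ν ≤
          (1 + divergenceD (fun y => |y| ^ (q / (q - 1)) - 1) ν) ^ (1 - 1 / q) *
            (∫ x, f x ^ q ∂prodMarginals ν) ^ (1 / q)) ∧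
    (∃ (m : ℕ) (ν' : Measure (Fin m → ℝ)), IsProbabilityMeasure ν' ∧
        ν' ≪ prodMarginals ν' ∧
        Integrable (fun x => Real.log (jointDensity ν' x)) ν' ∧
        ∃ f : (Fin m → ℝ) → ℝ, Measurable f ∧ (∀ x, 0 ≤ f x) ∧
          Integrable f ν' ∧ Integrable (fun x => Real.exp (f x)) (prodMarginals ν') ∧
          ∫ x, f x ∂ν' =
            (∫ x, Real.exp (f x) ∂prodMarginals ν') - 1 + relEntropy ν') ∧
    (∀ q : ℝ, 1 < q →
      ∃ (m : ℕ) (ν' : Measure (Fin m → ℝ)), IsProbabilityMeasure ν' ∧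
        ν' ≪ prodMarginals ν' ∧
        Integrable (fun x => |jointDensity ν' x| ^ (q / (q - 1))) (prodMarginals ν') ∧
        ∃ f : (Fin m → ℝ) → ℝ, Measurable f ∧ (∀ x, 0 ≤ f x) ∧
          Integrable f ν' ∧ Integrable (fun x => f x ^ q) (prodMarginals ν') ∧
          ∫ x, f x ∂ν' =
            (1 + divergenceD (fun y => |y| ^ (q / (q - 1)) - 1) ν') ^ (1 - 1 / q) *
              (∫ x, f x ^ q ∂prodMarginals ν') ^ (1 / q)) := by
  have hπ : prodMarginals (Measure.pi fun _ : Fin 2 => ProbabilityTheory.gaussianReal 0 1)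
      = Measure.pi fun _ => ProbabilityTheory.gaussianReal 0 1 := prodMarginals_pi _
  refine ⟨fun hlog f _ _ hf hexp => integral_le_integral_exp_add_relEntropy hac hlog hf hexp,
    fun q hq hG f hf h0 _ hfq => integral_le_one_add_divergenceD_rpow_mul hac hq hG hf h0 hfq,
    ⟨2, Measure.pi fun _ => ProbabilityTheory.gaussianReal 0 1, inferInstance,
      hπ.symm ▸ Measure.AbsolutelyContinuous.rfl,
      integrable_comp_jointDensity_pi _ Real.log, fun _ => 0, measurable_const,
      fun _ => le_rfl, integrable_const _, integrable_const _, ?_⟩,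
    fun q hq => ⟨2, Measure.pi fun _ => ProbabilityTheory.gaussianReal 0 1, inferInstance,
      hπ.symm ▸ Measure.AbsolutelyContinuous.rfl,
      ?_, fun _ => 1, measurable_const,
      fun _ => zero_le_one, integrable_const _, integrable_const _, ?_⟩⟩
  · simp [relEntropy_pi]
  · rw [hπ]
    exact integrable_comp_jointDensity_pi _ fun y => |y| ^ (q / (q - 1))
  · simp [divergenceD_pi]
end

section
/- Let X_1,…,X_n be random variables whose joint distribution is absolutely continuous with respect to the product of their marginals, ξ_1,…,ξ_n independent copies, and h : ℝ^n → ℝ a Borel statistic. Then for every x ∈ ℝ: (i) P(h(X_1,…,X_n) > x) ≤ P(h(ξ_1,…,ξ_n) > x) + φ_{X_1,…,X_n} (P(h(ξ_1,…,ξ_n) > x))^{1/2}; (ii) P(h(X_1,…,X_n) > x) ≤ (1 + φ²_{X_1,…,X_n})^{1/2} (P(h(ξ_1,…,ξ_n) > x))^{1/2}; (iii) P(h(X_1,…,X_n) > x) ≤ (e − 1) P(h(ξ_1,…,ξ_n) > x) + δ_{X_1,…,X_n}; (iv) for every q > 1, P(h(X_1,…,X_n) > x) ≤ (1 + D^ψ_{X_1,…,X_n})^{1−1/q}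 (P(h(ξ_1,…,ξ_n) > x))^{1/q}, where ψ(x) = |x|^{q/(q−1)} − 1. -/
open MeasureTheory Finset

/-- Hölder's inequality against the indicator of a set. -/
theorem setIntegral_le_integral_rpow_mul_measure_rpow {α : Type*} [MeasurableSpace α]
    {μ : Measure α} [IsFiniteMeasure μ] {f : α → ℝ} {p q : ℝ} (hpq : p.HolderConjugate q)
    (hf : AEStronglyMeasurable f μ) (hfp : Integrable (fun x => |f x| ^ p) μ)
    {s : Set α} (hs : MeasurableSet s) :
    ∫ x in s, f x ∂μ ≤ (∫ x, |f x| ^ p ∂μ) ^ (1 / p) * (μ s).toReal ^ (1 / q) := by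
  have hp0 : ENNReal.ofReal p ≠ 0 := by simpa using hpq.pos
  have hfm : MemLp f (ENNReal.ofReal p) μ := by
    rw [← integrable_norm_rpow_iff hf hp0 ENNReal.ofReal_ne_top,
      ENNReal.toReal_ofReal hpq.nonneg]
    exact hfp
  have hgm : MemLp (s.indicator fun _ => (1 : ℝ)) (ENNReal.ofReal q) μ :=
    memLp_indicator_const _ hs _ (Or.inr (measure_ne_top _ _))
  have key := integral_mul_norm_le_Lp_mul_Lq hpq hfm hgm
  have hg : ∫ x, ‖s.indicator (fun _ => (1 : ℝ)) x‖ ^ q ∂μ = (μ s).toReal := by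
    have : (fun x => ‖s.indicator (fun _ => (1 : ℝ)) x‖ ^ q) = s.indicator fun _ => (1 : ℝ) := by
      ext x
      by_cases hx : x ∈ s <;> simp [hx, hpq.symm.ne_zero]
    rw [this, integral_indicator_const _ hs]
    simp [Measure.real]
  rw [hg] at key
  calc ∫ x in s, f x ∂μ ≤ ∫ x in s, ‖f x‖ ∂μ :=
        (Real.le_norm_self _).trans (norm_integral_le_integral_norm _)
    _ = ∫ x, ‖f x‖ * ‖s.indicator (fun _ => (1 : ℝ)) x‖ ∂μ := by
        rw [← integral_indicator hs]
        refine integral_congr_ae (.of_forall fun x => ?_)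
        by_cases hx : x ∈ s <;> simp [hx]
    _ ≤ _ := key

theorem mul_le_mul_log_sub_add_exp {a : ℝ} (ha : 0 ≤ a) (b : ℝ) :
    a * b ≤ a * Real.log a - a + Real.exp b := by
  rcases ha.eq_or_lt with rfl | ha
  · simpa using (Real.exp_pos b).le
  · have h1 := Real.add_one_le_exp (b - Real.log a)
    rw [Real.exp_sub, Real.exp_log ha, le_div_iff₀ ha] at h1
    linarith

/-- The Donsker–Varadhan-type bound of `ν s` by `μ s` and the relative entropy. -/
theorem measure_le_exp_sub_one_mul_add_integral_log_rnDeriv {α : Type*} [MeasurableSpace α]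
    {μ ν : Measure α} [IsProbabilityMeasure μ] [IsProbabilityMeasure ν] (hac : ν ≪ μ)
    (hlog : Integrable (fun x => Real.log (ν.rnDeriv μ x).toReal) ν)
    {s : Set α} (hs : MeasurableSet s) :
    (ν s).toReal ≤ (Real.exp 1 - 1) * (μ s).toReal +
      ∫ x, Real.log (ν.rnDeriv μ x).toReal ∂ν := by
  set G : α → ℝ := fun x => (ν.rnDeriv μ x).toReal
  have hG : Integrable G μ := Measure.integrable_toReal_rnDeriv
  have hGlog : Integrable (fun x => G x * Real.log (G x)) μ :=
    (integrable_rnDeriv_smul_iff hac).2 hlog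
  have hGs : Integrable (s.indicator G) μ := hG.indicator hs
  have h1 : Integrable (s.indicator fun _ => Real.exp 1 - 1) μ :=
    (integrable_const _).indicator hs
  have h2 : Integrable (fun x => G x * Real.log (G x) - G x) μ := hGlog.sub hG
  have h3 : Integrable (fun x => s.indicator (fun _ => Real.exp 1 - 1) x + 1) μ :=
    h1.add (integrable_const _)
  have hle : ∫ x, s.indicator G x ∂μ ≤
      ∫ x, ((G x * Real.log (G x) - G x) + (s.indicator (fun _ => Real.exp 1 - 1) x + 1)) ∂μ := by
    refine integral_mono hGs (h2.add h3) fun x => ?_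
    have hx := mul_le_mul_log_sub_add_exp (a := G x) ENNReal.toReal_nonneg
      (s.indicator (fun _ => 1) x)
    by_cases hxs : x ∈ s <;> simp [hxs] at hx ⊢ <;> linarith
  rw [integral_add h2 h3, integral_sub hGlog hG,
    integral_add h1 (integrable_const _), integral_indicator hs, integral_indicator_const _ hs,
    Measure.setIntegral_toReal_rnDeriv hac, Measure.integral_toReal_rnDeriv hac] at hle
  have hint : ∫ x, G x * Real.log (G x) ∂μ = ∫ x, Real.log (G x) ∂ν := integral_rnDeriv_smul hac
  simp [Measure.real, hint] at hle
  linarith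

/-- Theorem 7.5: for random variables `X₁,…,Xₙ` with joint law `ν` absolutely continuous
w.r.t. the product of their marginals, independent copies `ξ₁,…,ξₙ` (joint law
`prodMarginals ν`), a Borel statistic `h : ℝⁿ → ℝ` and every `x ∈ ℝ`:
(i) `P(h(X) > x) ≤ P(h(ξ) > x) + φ P(h(ξ) > x)^{1/2}`;
(ii) `P(h(X) > x) ≤ (1 + φ²)^{1/2} P(h(ξ) > x)^{1/2}`;
(iii) `P(h(X) > x) ≤ (e - 1) P(h(ξ) > x) + δ`;
(iv) for every `q > 1`, `P(h(X) > x) ≤ (1 + D^ψ)^{1-1/q} P(h(ξ) > x)^{1/q}`, where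
`ψ(y) = |y|^{q/(q-1)} - 1`
(each inequality under the corresponding integrability condition making the dependence
measure well defined). -/
theorem statement19 (n : ℕ) (ν : Measure (Fin n → ℝ)) [IsProbabilityMeasure ν]
    (hac : ν ≪ prodMarginals ν)
    (h : (Fin n → ℝ) → ℝ) (hh : Measurable h) (x : ℝ) :
    (Integrable (fun y => jointDensity ν y ^ 2) (prodMarginals ν) →
      (ν {y | x < h y}).toReal ≤
          (prodMarginals ν {y | x < h y}).toReal +
            Real.sqrt (pearsonPhiSq ν) *
              Real.sqrt ((prodMarginals ν {y | x < h y}).toReal) ∧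
      (ν {y | x < h y}).toReal ≤
          Real.sqrt (1 + pearsonPhiSq ν) *
            Real.sqrt ((prodMarginals ν {y | x < h y}).toReal)) ∧
    (Integrable (fun y => Real.log (jointDensity ν y)) ν →
      (ν {y | x < h y}).toReal ≤
        (Real.exp 1 - 1) * (prodMarginals ν {y | x < h y}).toReal + relEntropy ν) ∧
    (∀ q : ℝ, 1 < q →
      Integrable (fun y => |jointDensity ν y| ^ (q / (q - 1))) (prodMarginals ν) →
      (ν {y | x < h y}).toReal ≤
        (1 + divergenceD (fun y => |y| ^ (q / (q - 1)) - 1) ν) ^ (1 - 1 / q) *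
          ((prodMarginals ν {y | x < h y}).toReal) ^ (1 / q)) := by
  have hs : MeasurableSet {y | x < h y} := measurableSet_lt measurable_const hh
  set s := {y | x < h y}
  set μ := prodMarginals ν
  have hG : Integrable (jointDensity ν) μ := Measure.integrable_toReal_rnDeriv
  have hGs : ∫ y in s, jointDensity ν y ∂μ = (ν s).toReal :=
    Measure.setIntegral_toReal_rnDeriv hac s
  have hG1 : ∫ y, jointDensity ν y ∂μ = 1 :=
    (Measure.integral_toReal_rnDeriv hac).trans (by simp)
  have holder_two : ∀ f : (Fin n → ℝ) → ℝ, AEStronglyMeasurable f μ →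
      Integrable (fun y => f y ^ 2) μ →
      ∫ y in s, f y ∂μ ≤ √(∫ y, f y ^ 2 ∂μ) * √(μ s).toReal := fun f hf hf2 => by
    have := setIntegral_le_integral_rpow_mul_measure_rpow Real.HolderConjugate.two_two hf
      (by simpa using hf2) hs
    simpa [Real.sqrt_eq_rpow] using this
  refine ⟨fun hG2 => ⟨?_, ?_⟩, fun hlog => ?_, fun q hq hGp => ?_⟩
  · have hsq : (fun y => (jointDensity ν y - 1) ^ 2) =
        fun y => jointDensity ν y ^ 2 - 2 * jointDensity ν y + 1 := by
      ext y; ring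
    have hi : Integrable (fun y => jointDensity ν y ^ 2 - 2 * jointDensity ν y) μ :=
      hG2.sub (hG.const_mul 2)
    have hφ : ∫ y, (jointDensity ν y - 1) ^ 2 ∂μ = pearsonPhiSq ν := by
      rw [hsq, integral_add hi (integrable_const _), integral_sub hG2 (hG.const_mul 2),
        integral_const_mul, hG1, pearsonPhiSq]
      simp
      ring
    have key := holder_two (fun y => jointDensity ν y - 1)
      (hG.sub (integrable_const _)).aestronglyMeasurable
      (by rw [hsq]; exact hi.add (integrable_const _))
    rw [hφ, integral_sub hG.integrableOn (integrable_const _), hGs] at key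
    simp [Measure.real] at key
    linarith
  · have key := holder_two _ hG.aestronglyMeasurable hG2
    rwa [hGs, ← add_sub_cancel 1 (∫ y, jointDensity ν y ^ 2 ∂μ)] at key
  · exact measure_le_exp_sub_one_mul_add_integral_log_rnDeriv hac hlog hs
  · have hpq : (q / (q - 1)).HolderConjugate q :=
      (Real.HolderConjugate.conjExponent hq).symm
    have key := setIntegral_le_integral_rpow_mul_measure_rpow hpq hG.aestronglyMeasurable hGp hs
    have hD : 1 + divergenceD (fun y => |y| ^ (q / (q - 1)) - 1) ν =
        ∫ y, |jointDensity ν y| ^ (q / (q - 1)) ∂μ := by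
      rw [divergenceD, integral_sub hGp (integrable_const _)]
      simp
    have hexp : 1 - 1 / q = 1 / (q / (q - 1)) := by
      have : q ≠ 0 := by positivity
      field_simp
    rwa [hD, hexp, ← hGs]
end
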